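/- arXiv:2005.08085 — 6 statements merged into one kernel-verified Lean document; each statement's English description precedes it below -/
import Mathlib

section
/- Let φ(z) = ∑_{n=0}^∞ φ_n z^n be an entire function on ℂ (a power series with infinite radius of convergence and complex coefficients). If the kernel (z,w) ↦ φ(z·conj(w)) is positive definite on ℂ, then every Taylor coefficient φ_n is a nonnegative real number. -/
open scoped ComplexOrder

/-- A kernel `K : X × X → ℂ` is positive definite if for every `n`, points `x : Fin n → X`
and coefficients `c : Fin n → ℂ`, the sum `∑ i j, c i * conj (c j) * K (x i) (x j)` is a
nonnegative real number (nonnegative in the complex order). -/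
def PosDefKernel {X : Type*} (K : X → X → ℂ) : Prop :=
  ∀ (n : ℕ) (x : Fin n → X) (c : Fin n → ℂ),
    0 ≤ ∑ i, ∑ j, c i * (starRingEnd ℂ) (c j) * K (x i) (x j)

open Filter Topology

/-- The character sum `∑ₖ ω^{kn} * conj (ω^{km})` over the powers of `ω`. -/
noncomputable def charSum (N : ℕ) (ω : ℂ) (m n : ℕ) : ℂ :=
  ∑ k : Fin N, (ω ^ (k : ℕ)) ^ n * (starRingEnd ℂ) ((ω ^ (k : ℕ)) ^ m)

theorem norm_charSum_le (N : ℕ) {ω : ℂ} (hω : ‖ω‖ = 1) (m n : ℕ) : ‖charSum N ω m n‖ ≤ N := by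
  refine (norm_sum_le _ _).trans ?_
  simp [hω]

theorem charSum_self (N : ℕ) {ω : ℂ} (hω : ‖ω‖ = 1) (m : ℕ) : charSum N ω m m = N := by
  simp only [charSum, Complex.mul_conj', norm_pow, hω]
  simp

theorem charSum_eq_zero {N : ℕ} {ω : ℂ} (hω : IsPrimitiveRoot ω N) (hnorm : ‖ω‖ = 1) {m n : ℕ}
    (hm : m < N) (hn : n < N) (hne : n ≠ m) : charSum N ω m n = 0 := by
  have hconj : ω ^ m * (starRingEnd ℂ) (ω ^ m) = 1 := by
    rw [Complex.mul_conj', norm_pow, hnorm]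
    simp
  set ζ := ω ^ n * (starRingEnd ℂ) (ω ^ m) with hζ
  have hζ1 : ζ ≠ 1 := by
    intro h
    apply hne
    apply hω.pow_inj hn hm
    calc ω ^ n = ω ^ m * ζ := by rw [hζ]; linear_combination (-ω ^ n) * hconj
      _ = ω ^ m := by rw [h, mul_one]
  have hζN : ζ ^ N = 1 := by
    rw [hζ, mul_pow, ← map_pow, ← pow_mul, ← pow_mul, mul_comm n, mul_comm m, pow_mul, pow_mul,
      hω.pow_eq_one]
    simp
  have hsum : charSum N ω m n = ∑ k ∈ Finset.range N, ζ ^ k := by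
    rw [charSum, ← Fin.sum_univ_eq_sum_range]
    refine Finset.sum_congr rfl fun k _ => ?_
    rw [hζ, mul_pow, ← map_pow, ← pow_mul, ← pow_mul, ← pow_mul, ← pow_mul, mul_comm n,
      mul_comm m]
  rw [hsum, geom_sum_eq hζ1, hζN, sub_self, zero_div]

theorem tsum_mul_normSq_charSum_nonneg {φ : ℂ → ℂ} {a : ℕ → ℂ}
    (hent : ∀ z : ℂ, HasSum (fun n => a n * z ^ n) (φ z))
    (hpd : PosDefKernel (fun z w : ℂ => φ (z * (starRingEnd ℂ) w))) (N : ℕ) (ω : ℂ) (m : ℕ) :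
    0 ≤ ∑' n, a n * (charSum N ω m n * (starRingEnd ℂ) (charSum N ω m n)) := by
  have hs := hasSum_sum (s := Finset.univ) fun (i : Fin N) _ =>
    hasSum_sum (s := Finset.univ) fun (j : Fin N) _ =>
      (hent (ω ^ (i : ℕ) * (starRingEnd ℂ) (ω ^ (j : ℕ)))).mul_left
        ((starRingEnd ℂ) ((ω ^ (i : ℕ)) ^ m) *
          (starRingEnd ℂ) ((starRingEnd ℂ) ((ω ^ (j : ℕ)) ^ m)))
  have key : ∀ n, a n * (charSum N ω m n * (starRingEnd ℂ) (charSum N ω m n)) =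
      ∑ i : Fin N, ∑ j : Fin N, ((starRingEnd ℂ) ((ω ^ (i : ℕ)) ^ m) *
          (starRingEnd ℂ) ((starRingEnd ℂ) ((ω ^ (j : ℕ)) ^ m))) *
        (a n * (ω ^ (i : ℕ) * (starRingEnd ℂ) (ω ^ (j : ℕ))) ^ n) := by
    intro n
    rw [charSum, map_sum, Finset.sum_mul_sum, Finset.mul_sum]
    refine Finset.sum_congr rfl fun i _ => ?_
    rw [Finset.mul_sum]
    refine Finset.sum_congr rfl fun j _ => ?_
    simp only [map_mul, map_pow, mul_pow]
    ring
  rw [tsum_congr key, hs.tsum_eq]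
  exact hpd N (fun i => ω ^ (i : ℕ)) fun i => (starRingEnd ℂ) ((ω ^ (i : ℕ)) ^ m)

/-- If `φ(z) = ∑ aₙ zⁿ` is entire (power series converging on all of `ℂ`) and the kernel
`(z, w) ↦ φ(z * conj w)` is positive definite on `ℂ`, then every Taylor coefficient `aₙ`
is a nonnegative real number. -/
theorem coefficients_nonneg_of_posDefKernel (φ : ℂ → ℂ) (a : ℕ → ℂ)
    (hent : ∀ z : ℂ, HasSum (fun n => a n * z ^ n) (φ z))
    (hpd : PosDefKernel (fun z w : ℂ => φ (z * (starRingEnd ℂ) w))) :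
    ∀ n : ℕ, ∃ r : ℝ, 0 ≤ r ∧ a n = (r : ℂ) := by
  intro m
  have hsummable : Summable fun n => ‖a n‖ := by simpa using (hent 1).summable.norm
  have hprim (N : ℕ) := Complex.isPrimitiveRoot_exp (N + 1) N.succ_ne_zero
  set ω : ℕ → ℂ := fun N => Complex.exp (2 * Real.pi * Complex.I / (N + 1 : ℕ))
  have hnorm (N : ℕ) : ‖ω N‖ = 1 := (hprim N).norm'_eq_one N.succ_ne_zero
  set s : ℕ → ℕ → ℂ := fun N n => charSum (N + 1) (ω N) m n / (N + 1 : ℕ) with hs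
  have hs_le (N n : ℕ) : ‖s N n‖ ≤ 1 := by
    rw [hs, norm_div, Complex.norm_natCast]
    exact div_le_one_of_le₀ (norm_charSum_le _ (hnorm N) m n) (Nat.cast_nonneg _)
  have hlim : Tendsto (fun N => ∑' n, a n * (s N n * (starRingEnd ℂ) (s N n))) atTop
      (𝓝 (∑' n, if n = m then a n else 0)) := by
    refine tendsto_tsum_of_dominated_convergence hsummable (fun n => ?_)
      (Eventually.of_forall fun N n => ?_)
    · refine tendsto_const_nhds.congr' ?_
      filter_upwards [eventually_ge_atTop (max m n)] with N hN
      split_ifs with h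
      · subst h
        have : ((N + 1 : ℕ) : ℂ) ≠ 0 := Nat.cast_ne_zero.mpr N.succ_ne_zero
        simp only [hs, charSum_self _ (hnorm N), div_self this, map_one, mul_one]
      · have hzero : charSum (N + 1) (ω N) m n = 0 :=
          charSum_eq_zero (hprim N) (hnorm N) (by omega) (by omega) h
        simp only [hs, hzero, zero_div, zero_mul, mul_zero]
    · rw [norm_mul, norm_mul, RCLike.norm_conj]
      exact mul_le_of_le_one_right (norm_nonneg _)
        (mul_le_one₀ (hs_le N n) (norm_nonneg _) (hs_le N n))
  rw [tsum_ite_eq] at hlim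
  have hnonneg : 0 ≤ a m := by
    refine ge_of_tendsto' hlim fun N => ?_
    have hscale (n : ℕ) : a n * (s N n * (starRingEnd ℂ) (s N n)) =
        (((N + 1 : ℕ) : ℝ)⁻¹ ^ 2 : ℝ) * (a n * (charSum (N + 1) (ω N) m n *
          (starRingEnd ℂ) (charSum (N + 1) (ω N) m n))) := by
      simp only [hs, map_div₀, map_natCast, Complex.ofReal_pow, Complex.ofReal_inv,
        Complex.ofReal_natCast]
      ring
    rw [tsum_congr hscale, tsum_mul_left]
    exact mul_nonneg (Complex.zero_le_real.mpr (by positivity))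
      (tsum_mul_normSq_charSum_nonneg hent hpd _ _ _)
  exact ⟨(a m).re, (Complex.nonneg_iff.mp hnonneg).1,
    Complex.eq_re_of_ofReal_le (r := 0) (by simpa using hnonneg)⟩
end

section
/- If φ and ψ belong to the class ML, then φ(1) is a real number ≥ 1 and the function z ↦ φ(ψ(z))/φ(1) belongs to the class ML; that is, it is entire, takes the value 1 at 0, has positive derivative at 0, the kernel (z,w) ↦ φ(ψ(z·conj(w)))/φ(1) is positive definite on ℂ, and the kernel (s₁,s₂) ↦ φ(ψ(−‖s₁−s₂‖²_{L²(ℝ)}/2))/φ(1) is positive definite on the real Schwartz space S(ℝ). -/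
open scoped ComplexOrder
open MeasureTheory

/-- The class `ML`: `φ` is entire (a power series converging on all of `ℂ`), `φ(0) = 1`,
`φ'(0)` is a positive real, the kernel `(z,w) ↦ φ(z·conj w)` is positive definite on `ℂ`,
and the kernel `(s₁,s₂) ↦ φ(−‖s₁−s₂‖²_{L²(ℝ)}/2)` is positive definite on the real Schwartz
space. -/
def IsML (φ : ℂ → ℂ) : Prop :=
  (∃ a : ℕ → ℂ, ∀ z : ℂ, HasSum (fun n => a n * z ^ n) (φ z)) ∧
  φ 0 = 1 ∧
  0 < deriv φ 0 ∧
  PosDefKernel (fun z w : ℂ => φ (z * (starRingEnd ℂ) w)) ∧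
  PosDefKernel (fun s₁ s₂ : SchwartzMap ℝ ℝ =>
    φ (Complex.ofReal (-(∫ x : ℝ, (s₁ x - s₂ x) ^ 2) / 2)))

theorem Matrix.posSemidef_of_dotProduct_mulVec_nonneg {n : Type*} [Fintype n]
    {M : Matrix n n ℂ} (h : ∀ v, 0 ≤ star v ⬝ᵥ M.mulVec v) : M.PosSemidef := by
  classical
  rw [← Matrix.isPositive_toEuclideanLin_iff, LinearMap.isPositive_iff_complex]
  intro v
  have hv : 0 ≤ inner ℂ (Matrix.toEuclideanLin M v) v := by
    rw [← inner_conj_symm, starRingEnd_apply, star_nonneg_iff]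
    convert h v.ofLp using 1
    simp [EuclideanSpace.inner_eq_star_dotProduct, Matrix.toLpLin_apply, dotProduct_comm]
  obtain ⟨hre, him⟩ := Complex.nonneg_iff.1 hv
  exact ⟨Complex.ext (by simp) (by simpa using him), hre⟩

namespace PosDefKernel

variable {X : Type*} {K L : X → X → ℂ}

theorem iff_posSemidef :
    PosDefKernel K ↔
      ∀ (n : ℕ) (x : Fin n → X), (Matrix.of fun i j => K (x i) (x j)).PosSemidef := by
  have key (n : ℕ) (x : Fin n → X) (c : Fin n → ℂ) :
      ∑ i, ∑ j, c i * (starRingEnd ℂ) (c j) * K (x i) (x j) =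
        star (star c) ⬝ᵥ (Matrix.of fun i j => K (x i) (x j)).mulVec (star c) := by
    simp only [dotProduct, Matrix.mulVec, Matrix.of_apply, Pi.star_apply,
      Finset.mul_sum, RCLike.star_def, Complex.conj_conj]
    exact Finset.sum_congr rfl fun i _ => Finset.sum_congr rfl fun j _ => by ring
  refine ⟨fun h n x => Matrix.posSemidef_of_dotProduct_mulVec_nonneg fun v => ?_,
    fun h n x c => ?_⟩
  · have := h n x (star v)
    rwa [key, star_star v] at this
  · rw [key]
    exact (h n x).dotProduct_mulVec_nonneg _

theorem mul (hK : PosDefKernel K) (hL : PosDefKernel L) :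
    PosDefKernel fun x y => K x y * L x y := by
  rw [iff_posSemidef] at *
  exact fun n x => (hK n x).hadamard (hL n x)

theorem one : PosDefKernel fun _ _ : X => (1 : ℂ) := by
  intro n x c
  have : ∑ i, ∑ j, c i * (starRingEnd ℂ) (c j) * 1 = (∑ i, c i) * star (∑ i, c i) := by
    simp [Finset.sum_mul_sum]
  rw [this]
  exact mul_star_self_nonneg _

theorem pow (hK : PosDefKernel K) (m : ℕ) : PosDefKernel fun x y => K x y ^ m := by
  induction m with
  | zero => simpa using one
  | succ m ih => simpa only [pow_succ] using ih.mul hK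

theorem div_const (hK : PosDefKernel K) {r : ℂ} (hr : 0 < r) :
    PosDefKernel fun x y => K x y / r := by
  intro n x c
  simp only [← mul_div_assoc, ← Finset.sum_div]
  rw [div_eq_mul_inv]
  exact mul_nonneg (hK n x c) (RCLike.inv_pos.2 hr).le

/-- A power series with nonnegative coefficients preserves positive definiteness. -/
theorem comp_hasSum (hK : PosDefKernel K) {a : ℕ → ℂ} {f : ℂ → ℂ}
    (hf : ∀ z, HasSum (fun n => a n * z ^ n) (f z)) (ha : ∀ n, 0 ≤ a n) :
    PosDefKernel fun x y => f (K x y) := by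
  intro n x c
  have hs : HasSum (fun k => ∑ i, ∑ j, c i * (starRingEnd ℂ) (c j) * (a k * K (x i) (x j) ^ k))
      (∑ i, ∑ j, c i * (starRingEnd ℂ) (c j) * f (K (x i) (x j))) :=
    hasSum_sum fun i _ => hasSum_sum fun j _ => (hf _).mul_left _
  refine hs.nonneg fun k => ?_
  have : ∑ i, ∑ j, c i * (starRingEnd ℂ) (c j) * (a k * K (x i) (x j) ^ k) =
      a k * ∑ i, ∑ j, c i * (starRingEnd ℂ) (c j) * K (x i) (x j) ^ k := by
    simp only [Finset.mul_sum]
    exact Finset.sum_congr rfl fun i _ => Finset.sum_congr rfl fun j _ => by ring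
  rw [this]
  exact mul_nonneg (ha k) (hK.pow k n x c)

end PosDefKernel

open Filter Topology in
/-- If `(z, w) ↦ f (z * conj w)` is positive definite, the Taylor coefficients of `f` are
nonnegative. -/
theorem coeff_nonneg_of_posDefKernel {a : ℕ → ℂ} {f : ℂ → ℂ}
    (hf : ∀ z, HasSum (fun n => a n * z ^ n) (f z))
    (hK : PosDefKernel fun z w : ℂ => f (z * (starRingEnd ℂ) w)) (m : ℕ) : 0 ≤ a m := by
  let ω : ℕ → ℂ := fun N => Complex.exp (2 * Real.pi * Complex.I / N)
  let g : ℕ → ℕ → ℂ := fun N k => (∑ i : Fin N, (ω N ^ k * star (ω N ^ m)) ^ (i : ℕ)) / N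
  have hω (N : ℕ) : ‖ω N‖ = 1 := by
    have : ω N = Complex.exp ((2 * Real.pi / N : ℝ) * Complex.I) := by
      simp only [ω]; push_cast; ring_nf
    rw [this, Complex.norm_exp_ofReal_mul_I]
  have hg_le (N k : ℕ) : ‖g N k‖ ≤ 1 := by
    rw [norm_div, Complex.norm_natCast]
    refine div_le_one_of_le₀ ((norm_sum_le _ _).trans ?_) (Nat.cast_nonneg _)
    simp [hω]
  have hg_self (N : ℕ) (hN : 0 < N) : g N m = 1 := by
    have : ω N ^ m * star (ω N ^ m) = 1 := by
      rw [← starRingEnd_apply, Complex.mul_conj']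
      simp [hω]
    have hN' : (N : ℂ) ≠ 0 := by exact_mod_cast hN.ne'
    simp only [g, this]
    simp [hN']
  have hg_ne (N k : ℕ) (hk : k ≠ m) (hkN : k < N) (hmN : m < N) : g N k = 0 := by
    have hprim : IsPrimitiveRoot (ω N) N := Complex.isPrimitiveRoot_exp N (by omega)
    set ζ := ω N ^ k * star (ω N ^ m) with hζ
    have hζN : ζ ^ N = 1 := by
      rw [hζ, mul_pow, ← star_pow, ← pow_mul, ← pow_mul, mul_comm k, mul_comm m, pow_mul,
        pow_mul, hprim.pow_eq_one]
      simp
    have hζ1 : ζ - 1 ≠ 0 := by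
      intro h
      apply hk
      apply hprim.pow_inj hkN hmN
      have h1 : star (ω N ^ m) * ω N ^ m = 1 := by
        rw [mul_comm, ← starRingEnd_apply, Complex.mul_conj']
        simp [hω]
      calc ω N ^ k = ζ * ω N ^ m := by rw [hζ, mul_assoc, h1, mul_one]
        _ = ω N ^ m := by rw [sub_eq_zero.1 h, one_mul]
    have hsum : ∑ i : Fin N, ζ ^ (i : ℕ) = 0 := by
      rw [Fin.sum_univ_eq_sum_range (fun i => ζ ^ i)]
      have := mul_geom_sum ζ N
      rw [hζN, sub_self] at this
      exact (mul_eq_zero.1 this).resolve_left hζ1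
    simp only [g, ← hζ, hsum, zero_div]
  have hS (N : ℕ) : 0 ≤ ∑' k, a k * (g N k * star (g N k)) := by
    have hs : HasSum (fun k => a k * (g N k * star (g N k)))
        (∑ i : Fin N, ∑ j : Fin N, (star (ω N ^ m) ^ (i : ℕ) / N) *
          (starRingEnd ℂ) (star (ω N ^ m) ^ (j : ℕ) / N) *
            f (ω N ^ (i : ℕ) * (starRingEnd ℂ) (ω N ^ (j : ℕ)))) := by
      have := hasSum_sum fun (i : Fin N) (_ : i ∈ Finset.univ) =>
        hasSum_sum fun (j : Fin N) (_ : j ∈ Finset.univ) =>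
          (hf (ω N ^ (i : ℕ) * (starRingEnd ℂ) (ω N ^ (j : ℕ)))).mul_left
            ((star (ω N ^ m) ^ (i : ℕ) / N) * (starRingEnd ℂ) (star (ω N ^ m) ^ (j : ℕ) / N))
      convert! this using 2 with k
      simp only [g, Finset.sum_div, star_sum, Finset.sum_mul_sum]
      simp only [Finset.mul_sum]
      refine Finset.sum_congr rfl fun i _ => Finset.sum_congr rfl fun j _ => ?_
      simp only [starRingEnd_apply, star_div₀, star_mul, star_pow, star_star, mul_pow, star_natCast]
      ring
    rw [hs.tsum_eq]
    exact hK N (fun i => ω N ^ (i : ℕ)) fun i => star (ω N ^ m) ^ (i : ℕ) / N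
  have hlim : Tendsto (fun N => ∑' k, a k * (g N k * star (g N k))) atTop
      (𝓝 (∑' k, if k = m then a m else 0)) := by
    have hsum : Summable fun k => ‖a k‖ := by simpa using (hf 1).summable.norm
    refine tendsto_tsum_of_dominated_convergence hsum (fun k => ?_) (.of_forall fun N k => ?_)
    · refine tendsto_const_nhds.congr' ?_
      filter_upwards [eventually_gt_atTop k, eventually_gt_atTop m] with N hk hm
      by_cases h : k = m
      · subst h
        simp [hg_self N (by omega)]
      · simp [h, hg_ne N k h hk hm]
    · rw [norm_mul, norm_mul, norm_star]
      exact mul_le_of_le_one_right (norm_nonneg _)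
        (mul_le_one₀ (hg_le N k) (norm_nonneg _) (hg_le N k))
  rw [tsum_ite_eq] at hlim
  exact ge_of_tendsto' hlim hS

theorem hasFPowerSeriesOnBall_ofScalars_of_hasSum {a : ℕ → ℂ} {f : ℂ → ℂ}
    (hf : ∀ z, HasSum (fun n => a n * z ^ n) (f z)) :
    HasFPowerSeriesOnBall f (FormalMultilinearSeries.ofScalars ℂ a) 0 ⊤ where
  r_le := by
    refine le_of_eq (ENNReal.eq_top_of_forall_nnreal_le fun r => ?_).symm
    refine FormalMultilinearSeries.le_radius_of_summable _ ?_
    simpa [FormalMultilinearSeries.ofScalars_norm] using (hf (r : ℝ)).summable.norm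
  r_pos := by simp
  hasSum := by
    intro y _
    simpa [FormalMultilinearSeries.ofScalars_apply_eq, mul_comm] using hf y

theorem differentiable_of_hasSum {a : ℕ → ℂ} {f : ℂ → ℂ}
    (hf : ∀ z, HasSum (fun n => a n * z ^ n) (f z)) : Differentiable ℂ f := by
  intro z
  exact ((hasFPowerSeriesOnBall_ofScalars_of_hasSum hf).differentiableOn z (by simp)).differentiableAt
    (by simp)

theorem coeff_one_eq_deriv_of_hasSum {a : ℕ → ℂ} {f : ℂ → ℂ}
    (hf : ∀ z, HasSum (fun n => a n * z ^ n) (f z)) : a 1 = deriv f 0 := by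
  rw [(hasFPowerSeriesOnBall_ofScalars_of_hasSum hf).hasFPowerSeriesAt.deriv]
  simp

theorem coeff_zero_eq_of_hasSum {a : ℕ → ℂ} {f : ℂ → ℂ}
    (hf : ∀ z, HasSum (fun n => a n * z ^ n) (f z)) : a 0 = f 0 := by
  refine (hasSum_single 0 fun n hn => ?_).unique (hf 0) |>.symm ▸ ?_
  all_goals simp_all

open Filter Topology in
/-- A power series with nonnegative coefficients has larger derivative at `1` than at `0`. -/
theorem deriv_zero_le_deriv_one_of_hasSum {a : ℕ → ℂ} {f : ℂ → ℂ}
    (hf : ∀ z, HasSum (fun n => a n * z ^ n) (f z)) (ha : ∀ n, 0 ≤ a n) :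
    deriv f 0 ≤ deriv f 1 := by
  have hd : HasDerivAt (fun x : ℝ => f x) (deriv f 1) 1 := by
    have := (differentiable_of_hasSum hf 1).hasDerivAt
    rw [← Complex.ofReal_one] at this
    simpa using this.comp_ofReal
  have ht : Tendsto (slope (fun x : ℝ => f x) 1) (𝓝[>] 1) (𝓝 (deriv f 1)) :=
    (hasDerivAt_iff_tendsto_slope.1 hd).mono_left
      (nhdsWithin_mono 1 fun x (hx : 1 < x) => hx.ne')
  refine ge_of_tendsto ht ?_
  filter_upwards [self_mem_nhdsWithin] with x (hx : 1 < x)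
  have hs := (hf x).sub (hf 1)
  have hle := le_hasSum hs 1 fun n _ => by
    have : (0 : ℂ) ≤ ((x ^ n - 1 : ℝ) : ℂ) :=
      Complex.zero_le_real.2 (sub_nonneg.2 (one_le_pow₀ hx.le))
    have h := mul_nonneg (ha n) this
    push_cast at h
    simpa [mul_sub] using h
  rw [← coeff_one_eq_deriv_of_hasSum hf, slope_def_module]
  have hpos : (0 : ℂ) < ((x - 1 : ℝ) : ℂ) := Complex.zero_lt_real.2 (sub_pos.2 hx)
  have hinv : (0 : ℂ) ≤ (((x - 1)⁻¹ : ℝ) : ℂ) :=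
    Complex.zero_le_real.2 (inv_nonneg.2 (sub_pos.2 hx).le)
  have h := mul_le_mul_of_nonneg_left hle hinv
  rw [Complex.real_smul, Complex.ofReal_one]
  refine le_trans (le_of_eq ?_) h
  have hne := hpos.ne'
  push_cast at hne ⊢
  field_simp

/-- If `φ` and `ψ` are of class `ML`, then `φ(1)` is a real number `≥ 1` (in the complex
order) and `z ↦ φ(ψ(z))/φ(1)` is again of class `ML`. -/
theorem isML_comp_div (φ ψ : ℂ → ℂ) (hφ : IsML φ) (hψ : IsML ψ) :
    1 ≤ φ 1 ∧ IsML (fun z => φ (ψ z) / φ 1) := by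
  obtain ⟨⟨a, ha⟩, hφ0, hφd, hφK, -⟩ := hφ
  obtain ⟨⟨b, hb⟩, hψ0, hψd, hψK, hψS⟩ := hψ
  have ha_nonneg := coeff_nonneg_of_posDefKernel ha hφK
  have h1 : 1 ≤ φ 1 := by
    have := le_hasSum (ha 1) 0 fun n _ => by simpa using ha_nonneg n
    simpa [coeff_zero_eq_of_hasSum ha, hφ0] using this
  have hpos : 0 < φ 1 := zero_lt_one.trans_le h1
  have hdφ := differentiable_of_hasSum ha
  have hdψ := differentiable_of_hasSum hb
  have hd : Differentiable ℂ fun z => φ (ψ z) / φ 1 := (hdφ.comp hdψ).div_const _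
  refine ⟨h1, ⟨fun n => (n.factorial : ℂ)⁻¹ * iteratedDeriv n (fun z => φ (ψ z) / φ 1) 0,
    fun z => ?_⟩, ?_, ?_, (hψK.comp_hasSum ha ha_nonneg).div_const hpos,
    (hψS.comp_hasSum ha ha_nonneg).div_const hpos⟩
  · have := Complex.hasSum_taylorSeries_of_entire hd 0 z
    simp only [sub_zero, smul_eq_mul] at this
    convert! this using 2 with n
    ring
  · simp [hψ0, hpos.ne']
  · have hφ1 : 0 < deriv φ 1 :=
      hφd.trans_le (deriv_zero_le_deriv_one_of_hasSum ha ha_nonneg)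
    have hc : HasDerivAt (fun z => φ (ψ z) / φ 1) (deriv φ 1 * deriv ψ 0 / φ 1) 0 := by
      refine HasDerivAt.div_const (HasDerivAt.comp 0 ?_ (hdψ 0).hasDerivAt) _
      rw [hψ0]
      exact (hdφ 1).hasDerivAt
    rw [hc.deriv, div_eq_mul_inv]
    exact mul_pos (mul_pos hφ1 hψd) (RCLike.inv_pos.2 hpos)
end

section
/- Let (Ω, P) be a probability space, m ∈ ℕ, and X₁, …, X_m real random variables on Ω. Suppose there exist real-valued functions s₁, …, s_m ∈ L²(ℝ, dx) and an entire function φ with real Taylor coefficients such that for every t = (t₁,…,t_m) ∈ ℝ^m, E[exp(i·∑_{j=1}^m t_j X_j)] = φ(−‖∑_{j=1}^m t_j s_j‖²_{L²(ℝ)}/2). Let γ₁, …, γ_m ∈ ℕ with ∑_j γ_j odd, and assume the product ∏_{j=1}^m |X_j|^{γ_j} is P-integrable. Then E[∏_{j=1}^m X_j^{γ_j}] = 0. -/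
open MeasureTheory

open Filter Topology in
/-- An everywhere convergent complex power series tends to its value at `0` there. -/
theorem tendsto_zero_of_hasSum_pow {a : ℕ → ℂ} {φ : ℂ → ℂ}
    (h : ∀ z : ℂ, HasSum (fun n => a n * z ^ n) (φ z)) : Tendsto φ (𝓝 0) (𝓝 (φ 0)) := by
  have hφ : φ = fun z => ∑' n, a n * z ^ n := funext fun z => (h z).tsum_eq.symm
  have hs : Summable fun n => ‖a n‖ := by simpa using (h 1).summable.norm
  have hc : ContinuousOn φ (Metric.closedBall 0 1) := by
    rw [hφ]
    refine continuousOn_tsum (fun n => by fun_prop) hs fun n z hz => ?_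
    rw [norm_mul, norm_pow]
    exact mul_le_of_le_one_right (norm_nonneg _)
      (pow_le_one₀ (norm_nonneg _) (by simpa using hz))
  exact hc.continuousAt (Metric.closedBall_mem_nhds 0 one_pos)

open Filter Topology in
/-- A real function `f` is a.e. measurable as soon as `exp (i ε f)` has nonzero integral
for all small `ε`. -/
theorem aemeasurable_of_eventually_integral_exp_ne_zero {Ω : Type*} [MeasurableSpace Ω]
    {P : Measure Ω} {f : Ω → ℝ}
    (h : ∀ᶠ ε : ℝ in 𝓝 0, ∫ ω, Complex.exp (Complex.I * ((ε * f ω : ℝ) : ℂ)) ∂P ≠ 0) :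
    AEMeasurable f P := by
  have hm : ∀ᶠ ε : ℝ in 𝓝 0, AEMeasurable (fun ω => ε⁻¹ * Real.sin (ε * f ω)) P := by
    filter_upwards [h] with ε hε
    have hi := (not_imp_comm.1 integral_undef hε).aestronglyMeasurable.aemeasurable
    have := (Complex.measurable_im.comp_aemeasurable hi).const_mul ε⁻¹
    refine this.congr (ae_of_all _ fun ω => ?_)
    simp only [Function.comp_apply, mul_comm Complex.I, Complex.exp_ofReal_mul_I_im]
  have hlim : Tendsto (fun n : ℕ => 1 / ((n : ℝ) + 1)) atTop (𝓝 0) :=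
    tendsto_one_div_add_atTop_nhds_zero_nat
  obtain ⟨N, hN⟩ := eventually_atTop.1 (hlim.eventually hm)
  refine aemeasurable_of_tendsto_metrizable_ae atTop
    (fun n => hN (n + N) (Nat.le_add_left N n)) (ae_of_all _ fun ω => ?_)
  have hd : HasDerivAt (fun ε : ℝ => Real.sin (ε * f ω)) (f ω) 0 := by
    simpa using ((hasDerivAt_id (0 : ℝ)).mul_const (f ω)).sin
  have hslope := hd.tendsto_slope_zero
  simp only [zero_add, zero_mul, Real.sin_zero, sub_zero, smul_eq_mul] at hslope
  refine hslope.comp (tendsto_nhdsWithin_iff.2 ⟨hlim.comp (tendsto_add_atTop_nat N), ?_⟩)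
  exact Eventually.of_forall fun n => (Nat.one_div_pos_of_nat (n := n + N)).ne'

/-- A random vector whose characteristic function is even has a symmetric law. -/
theorem map_eq_map_neg_of_integral_exp {Ω : Type*} [MeasurableSpace Ω] {P : Measure Ω}
    [IsFiniteMeasure P] {ι : Type*} [Fintype ι] {Y : Ω → ι → ℝ} (hY : AEMeasurable Y P)
    (h : ∀ t : ι → ℝ,
      ∫ ω, Complex.exp (Complex.I * ((∑ j, (-t) j * Y ω j : ℝ) : ℂ)) ∂P
        = ∫ ω, Complex.exp (Complex.I * ((∑ j, t j * Y ω j : ℝ) : ℂ)) ∂P) :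
    P.map Y = P.map (-Y) := by
  classical
  refine Measure.ext_of_charFunDual (funext fun L => ?_)
  let t : ι → ℝ := fun j => L (Pi.single j 1)
  have hL (v : ι → ℝ) : L v = ∑ j, t j * v j := by
    conv_lhs => rw [pi_eq_sum_univ' v, map_sum]
    exact Finset.sum_congr rfl fun j _ => by
      rw [map_smul, smul_eq_mul, mul_comm]
  have hc : Continuous fun v : ι → ℝ => Complex.exp (L v * Complex.I) := by fun_prop
  rw [charFunDual_apply, charFunDual_apply, integral_map hY hc.aestronglyMeasurable,
    integral_map hY.neg hc.aestronglyMeasurable]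
  simpa [hL, mul_comm Complex.I] using (h t).symm

/-- If the joint characteristic function of real random variables `X₁, …, X_m` is of the
form `E[exp(i ∑ tⱼ Xⱼ)] = φ(−‖∑ tⱼ sⱼ‖²_{L²(ℝ)}/2)` for some `s₁, …, s_m ∈ L²(ℝ)` and an
entire function `φ` with real Taylor coefficients, then every odd mixed moment vanishes:
`E[∏ Xⱼ^{γⱼ}] = 0` whenever `∑ γⱼ` is odd and the product is integrable. -/
theorem odd_moments_vanish {Ω : Type*} [MeasurableSpace Ω] (P : Measure Ω)
    [IsProbabilityMeasure P] (m : ℕ) (X : Fin m → Ω → ℝ)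
    (s : Fin m → Lp ℝ 2 (volume : Measure ℝ))
    (φ : ℂ → ℂ) (a : ℕ → ℝ)
    (hent : ∀ z : ℂ, HasSum (fun n => (a n : ℂ) * z ^ n) (φ z))
    (hchar : ∀ t : Fin m → ℝ,
      ∫ ω, Complex.exp (Complex.I * ((∑ j, t j * X j ω : ℝ) : ℂ)) ∂P
        = φ (Complex.ofReal (-(‖∑ j, t j • s j‖ ^ 2) / 2)))
    (γ : Fin m → ℕ) (hodd : Odd (∑ j, γ j))
    (hint : Integrable (fun ω => ∏ j, |X j ω| ^ γ j) P) :
    ∫ ω, ∏ j, (X j ω) ^ γ j ∂P = 0 := by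
  have hφ0 : φ 0 = 1 := by simpa using (hchar 0).symm
  have hX (j : Fin m) : AEMeasurable (X j) P := by
    refine aemeasurable_of_eventually_integral_exp_ne_zero ?_
    have hg : Filter.Tendsto (fun ε : ℝ => Complex.ofReal (-(‖ε • s j‖ ^ 2) / 2))
        (nhds 0) (nhds 0) := by
      have : Continuous fun ε : ℝ => Complex.ofReal (-(‖ε • s j‖ ^ 2) / 2) := by fun_prop
      simpa using this.tendsto 0
    have hne := ((tendsto_zero_of_hasSum_pow hent).comp hg).eventually_ne
      (b₂ := 0) (by simp [hφ0])
    filter_upwards [hne] with ε hε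
    have := hchar (Pi.single j ε)
    simp only [Pi.single_apply, ite_mul, ite_smul, zero_mul, zero_smul, Finset.sum_ite_eq',
      Finset.mem_univ, if_true] at this
    rwa [this]
  let Y : Ω → Fin m → ℝ := fun ω j => X j ω
  have hY : AEMeasurable Y P := aemeasurable_pi_lambda _ hX
  have hsymm : P.map Y = P.map (-Y) := by
    refine map_eq_map_neg_of_integral_exp hY fun t => ?_
    rw [hchar, hchar]
    simp only [Pi.neg_apply, neg_smul, Finset.sum_neg_distrib, norm_neg]
  have hf : Continuous fun v : Fin m → ℝ => ∏ j, v j ^ γ j := by fun_prop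
  have hneg (v : Fin m → ℝ) : ∏ j, (-v j) ^ γ j = -∏ j, v j ^ γ j := by
    simp_rw [neg_pow (v _), Finset.prod_mul_distrib, Finset.prod_pow_eq_pow_sum,
      hodd.neg_one_pow, neg_one_mul]
  have key : ∫ ω, ∏ j, Y ω j ^ γ j ∂P = ∫ ω, ∏ j, (-Y ω j) ^ γ j ∂P := by
    rw [← integral_map hY hf.aestronglyMeasurable, hsymm,
      integral_map hY.neg hf.aestronglyMeasurable]
    rfl
  simp_rw [hneg, integral_neg] at key
  exact self_eq_neg.1 key
end

section
/- Let (Ω, P) be a probability space and X a real random variable on Ω such that for every r > 0 the series ∑_{k=0}^∞ E[|X|^k]·r^k/k! converges. Suppose there exist σ ≥ 0 and an entire function φ(z) = ∑_{n=0}^∞ φ_n z^n such that for all t ∈ ℝ, E[exp(itX)] = φ(−t²σ²/2). Then for every n ∈ ℕ, E[X^{2n}] = (2n)!·φ_n·σ^{2n}/2^n. -/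
open MeasureTheory

open Filter Topology

/-- The power series with coefficients `c`. -/
noncomputable def coeffSeries (𝕜 : Type*) [NontriviallyNormedField 𝕜] {E : Type*}
    [NormedAddCommGroup E] [NormedSpace 𝕜 E] (c : ℕ → E) : FormalMultilinearSeries 𝕜 𝕜 E :=
  fun n => ContinuousMultilinearMap.mkPiRing 𝕜 (Fin n) (c n)

lemma coeffSeries_coeff {𝕜 : Type*} [NontriviallyNormedField 𝕜] {E : Type*}
    [NormedAddCommGroup E] [NormedSpace 𝕜 E] (c : ℕ → E) (n : ℕ) :
    (coeffSeries 𝕜 c).coeff n = c n := by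
  simp [coeffSeries, FormalMultilinearSeries.coeff]

lemma hasFPowerSeriesAt_coeffSeries {𝕜 : Type*} [NontriviallyNormedField 𝕜] {E : Type*}
    [NormedAddCommGroup E] [NormedSpace 𝕜 E] {c : ℕ → E} {f : 𝕜 → E}
    (h : ∀ z, HasSum (fun n => z ^ n • c n) (f z)) :
    HasFPowerSeriesAt f (coeffSeries 𝕜 c) 0 := by
  rw [hasFPowerSeriesAt_iff]
  simpa only [coeffSeries_coeff, zero_add] using Eventually.of_forall h

/-- The coefficients of an everywhere convergent power series are determined by its sum. -/
lemma coeff_eq_of_hasSum_pow_smul {𝕜 : Type*} [NontriviallyNormedField 𝕜] {E : Type*}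
    [NormedAddCommGroup E] [NormedSpace 𝕜 E] {c d : ℕ → E} {f : 𝕜 → E}
    (hc : ∀ z, HasSum (fun n => z ^ n • c n) (f z))
    (hd : ∀ z, HasSum (fun n => z ^ n • d n) (f z)) : c = d := by
  funext n
  rw [← coeffSeries_coeff (𝕜 := 𝕜) c n, ← coeffSeries_coeff (𝕜 := 𝕜) d n,
    (hasFPowerSeriesAt_coeffSeries hc).eq_formalMultilinearSeries
      (hasFPowerSeriesAt_coeffSeries hd)]

/-- If `exp(itX)` is a.e. strongly measurable for all small `t`, then so is `X`. -/
lemma aestronglyMeasurable_of_exp {Ω : Type*} [MeasurableSpace Ω] {P : Measure Ω} {X : Ω → ℝ}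
    (h : ∀ᶠ t : ℝ in 𝓝 0,
      AEStronglyMeasurable (fun ω => Complex.exp (Complex.I * (t : ℂ) * (X ω : ℂ))) P) :
    AEStronglyMeasurable X P := by
  have hX : AEStronglyMeasurable (fun ω => Complex.I * (X ω : ℂ)) P := by
    obtain ⟨ε, hε, hball⟩ := Metric.eventually_nhds_iff.1 h
    let D : ℝ → Ω → ℂ := fun t ω =>
      t⁻¹ • (Complex.exp (Complex.I * (t : ℂ) * (X ω : ℂ)) - 1)
    have hu : Tendsto (fun n : ℕ => ε / (n + 2)) atTop (𝓝[≠] 0) := by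
      refine tendsto_nhdsWithin_iff.2 ⟨?_, Eventually.of_forall fun n => ?_⟩
      · exact tendsto_const_nhds.div_atTop
          (tendsto_atTop_add_const_right _ _ tendsto_natCast_atTop_atTop)
      · have : 0 < ε / ((n : ℝ) + 2) := by positivity
        exact this.ne'
    refine aestronglyMeasurable_of_tendsto_ae atTop
      (f := fun n : ℕ => D (ε / (n + 2))) (fun n => ?_) (Eventually.of_forall fun ω => ?_)
    · refine ((hball ?_).sub aestronglyMeasurable_const).const_smul (ε / ((n : ℝ) + 2))⁻¹
      rw [Real.dist_eq, sub_zero, abs_of_pos (by positivity)]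
      exact div_lt_self hε (by linarith [(Nat.cast_nonneg n : (0 : ℝ) ≤ n)])
    · have hd : HasDerivAt (fun t : ℝ => Complex.exp (Complex.I * (t : ℂ) * (X ω : ℂ)))
          (Complex.I * (X ω : ℂ)) 0 := by
        have h1 := (((Complex.ofRealCLM.hasDerivAt (x := 0)).const_mul Complex.I).mul_const
          (X ω : ℂ)).cexp
        simpa using h1
      have ht := hd.tendsto_slope_zero.comp hu
      simpa [D, Function.comp_def] using ht
  simpa using Complex.continuous_im.comp_aestronglyMeasurable hX

/-- The characteristic function is the sum of its moment series when the exponential moments,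
computed termwise, are finite. -/
lemma hasSum_integral_exp {Ω : Type*} [MeasurableSpace Ω] {P : Measure Ω} {X : Ω → ℝ}
    (hX : AEStronglyMeasurable X P) (hint : ∀ k : ℕ, Integrable (fun ω => |X ω| ^ k) P)
    (hmom : ∀ r : ℝ, 0 < r →
      Summable (fun k : ℕ => (∫ ω, |X ω| ^ k ∂P) * r ^ k / (k.factorial : ℝ))) (t : ℝ) :
    HasSum (fun k : ℕ => t ^ k •
        (Complex.I ^ k * ((∫ ω, X ω ^ k ∂P : ℝ) : ℂ) / (k.factorial : ℂ)))
      (∫ ω, Complex.exp (Complex.I * (t : ℂ) * (X ω : ℂ)) ∂P) := by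
  let F : ℕ → Ω → ℂ := fun k ω => (Complex.I * (t : ℂ) * (X ω : ℂ)) ^ k / (k.factorial : ℂ)
  have hnorm (k : ℕ) (ω : Ω) : ‖F k ω‖ = |X ω| ^ k * (|t| ^ k / (k.factorial : ℝ)) := by
    simp only [F, norm_div, norm_pow, norm_mul, Complex.norm_I, Complex.norm_real,
      Real.norm_eq_abs, Complex.norm_natCast]
    ring
  have hF (k : ℕ) : Integrable (F k) P := by
    rw [← integrable_norm_iff]
    · simp_rw [hnorm]
      exact (hint k).mul_const _
    · have : AEStronglyMeasurable (fun ω => (X ω : ℂ)) P :=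
        Complex.continuous_ofReal.comp_aestronglyMeasurable hX
      simp only [F, div_eq_mul_inv]
      exact ((this.const_mul _).pow k).mul_const _
  have hsum : Summable fun k => ∫ ω, ‖F k ω‖ ∂P := by
    refine Summable.of_nonneg_of_le (fun k => by positivity) (fun k => ?_)
      (hmom (|t| + 1) (by positivity))
    simp_rw [hnorm, integral_mul_const]
    have : 0 ≤ ∫ ω, |X ω| ^ k ∂P := integral_nonneg fun ω => by positivity
    rw [mul_div_assoc]
    gcongr
    linarith
  convert! hasSum_integral_of_summable_integral_norm hF hsum using 1
  · funext k
    have (ω : Ω) : F k ω = (X ω ^ k : ℝ) * ((Complex.I * t) ^ k / (k.factorial : ℂ)) := by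
      simp only [F]
      push_cast
      ring
    simp_rw [this, integral_mul_const, integral_complex_ofReal, Complex.real_smul]
    push_cast
    ring
  · congr with ω
    rw [Complex.exp_eq_exp_ℂ, NormedSpace.exp_eq_tsum_div]

/-- If a real random variable `X` has all absolute moments finite with
`∑ E[|X|^k] r^k / k!` convergent for every `r > 0`, and its characteristic function is
`E[exp(itX)] = φ(−t²σ²/2)` for some `σ ≥ 0` and an entire `φ(z) = ∑ aₙ zⁿ`, then
`E[X^{2n}] = (2n)! · aₙ · σ^{2n} / 2ⁿ` for every `n`. -/
theorem even_moments {Ω : Type*} [MeasurableSpace Ω] (P : Measure Ω)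
    [IsProbabilityMeasure P] (X : Ω → ℝ)
    (hint : ∀ k : ℕ, Integrable (fun ω => |X ω| ^ k) P)
    (hmom : ∀ r : ℝ, 0 < r →
      Summable (fun k : ℕ => (∫ ω, |X ω| ^ k ∂P) * r ^ k / (k.factorial : ℝ)))
    (σ : ℝ) (hσ : 0 ≤ σ)
    (φ : ℂ → ℂ) (a : ℕ → ℂ)
    (hent : ∀ z : ℂ, HasSum (fun n => a n * z ^ n) (φ z))
    (hchar : ∀ t : ℝ,
      ∫ ω, Complex.exp (Complex.I * (t : ℂ) * (X ω : ℂ)) ∂P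
        = φ (Complex.ofReal (-(t ^ 2 * σ ^ 2) / 2))) :
    ∀ n : ℕ, ((∫ ω, X ω ^ (2 * n) ∂P : ℝ) : ℂ)
      = ((2 * n).factorial : ℂ) * a n * (σ : ℂ) ^ (2 * n) / 2 ^ n := by
  have hX : AEStronglyMeasurable X P := by
    refine aestronglyMeasurable_of_exp ?_
    have hφ : ContinuousAt φ 0 := (hasFPowerSeriesAt_coeffSeries (𝕜 := ℂ) (c := a)
      (by simpa only [smul_eq_mul, mul_comm] using hent)).continuousAt
    have h0 : φ 0 = 1 := by simpa using (hchar 0).symm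
    have hlim : Tendsto (fun t : ℝ => Complex.ofReal (-(t ^ 2 * σ ^ 2) / 2)) (𝓝 0) (𝓝 0) :=
      Continuous.tendsto' (by fun_prop) _ _ (by simp)
    filter_upwards [(hφ.tendsto.comp hlim).eventually_ne (by rw [h0]; exact one_ne_zero)]
      with t ht
    exact (Integrable.of_integral_ne_zero (by rw [hchar]; exact ht)).aestronglyMeasurable
  let d : ℕ → ℂ := fun k => if Even k then a (k / 2) * (-(σ : ℂ) ^ 2 / 2) ^ (k / 2) else 0
  have hd (t : ℝ) : HasSum (fun k => t ^ k • d k)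
      (∫ ω, Complex.exp (Complex.I * (t : ℂ) * (X ω : ℂ)) ∂P) := by
    rw [hchar, ← (mul_right_injective₀ (two_ne_zero' ℕ)).hasSum_iff]
    · convert! hent (Complex.ofReal (-(t ^ 2 * σ ^ 2) / 2)) using 1
      funext n
      simp only [Function.comp_apply, d, even_two_mul, if_true, Complex.real_smul,
        Nat.mul_div_cancel_left n two_pos]
      push_cast
      rw [pow_mul, mul_left_comm, ← mul_pow]
      ring
    · intro k hk
      have : ¬ Even k := fun ⟨m, hm⟩ => hk ⟨m, by simp only [hm, two_mul]⟩
      simp [d, this]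
  intro n
  have key := congrFun (coeff_eq_of_hasSum_pow_smul (hasSum_integral_exp hX hint hmom) hd) (2 * n)
  simp only [d, even_two_mul, if_true, Nat.mul_div_cancel_left n two_pos] at key
  have hfac : ((2 * n).factorial : ℂ) ≠ 0 := by exact_mod_cast (2 * n).factorial_ne_zero
  rw [pow_mul, Complex.I_sq, neg_div, neg_pow ((σ : ℂ) ^ 2 / 2), div_eq_iff hfac,
    mul_left_comm, mul_assoc ((-1 : ℂ) ^ n)] at key
  rw [mul_left_cancel₀ (pow_ne_zero n (neg_ne_zero.2 one_ne_zero)) key, div_pow, pow_mul]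
  ring
end

section
/- Let (Ω, P) be a probability space, m ∈ ℕ, and X₁, …, X_m real random variables on Ω such that for every r > 0 the series ∑_{k=0}^∞ E[(|X₁|+⋯+|X_m|)^k]·r^k/k! converges. Suppose there is an entire function φ(z) = ∑_{n=0}^∞ φ_n z^n such that for all t = (t₁,…,t_m) ∈ ℝ^m, E[exp(i·∑_{j=1}^m t_j X_j)] = φ(−(∑_{j=1}^m t_j²)/2). Then for all β₁, …, β_m ∈ ℕ with n := ∑_j β_j, E[∏_{j=1}^m X_j^{2β_j}] = (n!·φ_n/2^n)·∏_{j=1}^m (2β_j)!/β_j!. -/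
open MeasureTheory

open Filter Topology in
/-- An everywhere convergent power series is the Taylor series of its sum at `0`. -/
theorem hasFPowerSeriesAt_of_forall_hasSum {𝕜 E : Type*} [NontriviallyNormedField 𝕜]
    [NormedAddCommGroup E] [NormedSpace 𝕜 E] {c : ℕ → E} {f : 𝕜 → E}
    (h : ∀ z, HasSum (fun n => z ^ n • c n) (f z)) :
    HasFPowerSeriesAt f
      (fun n => ContinuousMultilinearMap.mkPiRing 𝕜 (Fin n) (c n)) 0 := by
  obtain ⟨z, hz⟩ := NormedField.exists_norm_lt 𝕜 (show (0 : ℝ) < 1 by norm_num)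
  refine ⟨‖z‖₊, ?_, ?_, ?_⟩
  · refine FormalMultilinearSeries.le_radius_of_tendsto (l := 0) _ ?_
    have := (h z).summable.tendsto_atTop_zero.norm
    simpa [norm_smul, mul_comm] using this
  · simpa using hz.1
  · intro y _
    simpa using h y

/-- Coefficients of everywhere convergent power series with the same sum agree. -/
theorem eq_of_forall_hasSum_pow_smul {𝕜 E : Type*} [NontriviallyNormedField 𝕜]
    [NormedAddCommGroup E] [NormedSpace 𝕜 E] {c d : ℕ → E} {f : 𝕜 → E}
    (hc : ∀ z, HasSum (fun n => z ^ n • c n) (f z))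
    (hd : ∀ z, HasSum (fun n => z ^ n • d n) (f z)) : c = d := by
  have h := (hasFPowerSeriesAt_of_forall_hasSum hc).eq_formalMultilinearSeries
    (hasFPowerSeriesAt_of_forall_hasSum hd)
  funext n
  simpa [FormalMultilinearSeries.coeff] using congrArg (fun p => p.coeff n) h

open Filter Topology in
/-- A real function is a.e. strongly measurable as soon as its characters of small frequency
are. -/
theorem aestronglyMeasurable_of_eventually_exp {Ω : Type*} [MeasurableSpace Ω] {P : Measure Ω}
    {X : Ω → ℝ}
    (h : ∀ᶠ s : ℝ in 𝓝[≠] 0,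
      AEStronglyMeasurable (fun ω => Complex.exp (Complex.I * ((s * X ω : ℝ) : ℂ))) P) :
    AEStronglyMeasurable X P := by
  obtain ⟨s, hs, hsm⟩ := exists_seq_forall_of_frequently (l := 𝓝[≠] (0 : ℝ)) h.frequently
  refine aestronglyMeasurable_of_tendsto_ae atTop (f := fun n ω => (s n)⁻¹ * Real.sin (s n * X ω))
    (fun n => ?_) (ae_of_all _ fun ω => ?_)
  · have : AEStronglyMeasurable
        (fun ω => (Complex.exp (Complex.I * ((s n * X ω : ℝ) : ℂ))).im) P :=
      Complex.continuous_im.comp_aestronglyMeasurable (hsm n)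
    refine (this.const_mul (s n)⁻¹).congr (ae_of_all _ fun ω => ?_)
    simp only [mul_comm Complex.I, Complex.exp_ofReal_mul_I_im]
  · have hd : HasDerivAt (fun t => Real.sin (t * X ω)) (X ω) 0 := by
      simpa using ((hasDerivAt_id (0 : ℝ)).mul_const (X ω)).sin
    simpa [Function.comp_def] using hd.tendsto_slope_zero.comp hs

/-- The characteristic function of a random variable dominated by one with finite exponential
moments of every order is the sum of its Taylor series. -/
theorem hasSum_integral_exp_of_abs_le {Ω : Type*} [MeasurableSpace Ω] {P : Measure Ω}
    {S Y : Ω → ℝ} {C : ℝ} (hC : 0 ≤ C) (hY : AEStronglyMeasurable Y P)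
    (hYS : ∀ ω, |Y ω| ≤ C * S ω) (hint : ∀ k : ℕ, Integrable (fun ω => S ω ^ k) P)
    (hS : ∀ ω, 0 ≤ S ω)
    (hmom : ∀ r : ℝ, 0 < r →
      Summable (fun k : ℕ => (∫ ω, S ω ^ k ∂P) * r ^ k / (k.factorial : ℝ))) (s : ℝ) :
    HasSum (fun k : ℕ => s ^ k •
        (Complex.I ^ k * ((∫ ω, Y ω ^ k ∂P : ℝ) : ℂ) / (k.factorial : ℂ)))
      (∫ ω, Complex.exp (Complex.I * ((s * Y ω : ℝ) : ℂ)) ∂P) := by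
  have hbound (k : ℕ) (ω : Ω) : |Y ω ^ k| ≤ C ^ k * S ω ^ k := by
    rw [abs_pow, ← mul_pow]
    exact pow_le_pow_left₀ (abs_nonneg _) (hYS ω) k
  have hYint (k : ℕ) : Integrable (fun ω => Y ω ^ k) P :=
    ((hint k).const_mul (C ^ k)).mono' (hY.pow k) (ae_of_all _ (hbound k))
  have hnorm (k : ℕ) (ω : Ω) :
      ‖(Complex.I * ((s * Y ω : ℝ) : ℂ)) ^ k / (k.factorial : ℂ)‖
        = |s| ^ k * |Y ω ^ k| / (k.factorial : ℝ) := by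
    simp [mul_pow, abs_pow]
  have hterm (k : ℕ) (ω : Ω) : (Complex.I * ((s * Y ω : ℝ) : ℂ)) ^ k / (k.factorial : ℂ)
      = ((s : ℂ) ^ k * Complex.I ^ k / (k.factorial : ℂ)) * ((Y ω ^ k : ℝ) : ℂ) := by
    push_cast
    ring
  have key := hasSum_integral_of_summable_integral_norm (μ := P)
    (F := fun (k : ℕ) ω => (Complex.I * ((s * Y ω : ℝ) : ℂ)) ^ k / (k.factorial : ℂ))
    (fun k => by
      simp_rw [hterm]
      exact (hYint k).ofReal.const_mul _)
    (by
      refine Summable.of_nonneg_of_le (fun k => integral_nonneg fun ω => norm_nonneg _)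
        (fun k => ?_) (hmom (|s| * C + 1) (by positivity))
      simp_rw [hnorm]
      rw [integral_div, integral_const_mul]
      refine div_le_div_of_nonneg_right ?_ (by positivity)
      calc |s| ^ k * ∫ ω, |Y ω ^ k| ∂P
          ≤ |s| ^ k * ∫ ω, C ^ k * S ω ^ k ∂P := by
            gcongr
            · exact (hYint k).abs
            · exact (hint k).const_mul _
            · exact fun ω => hbound k ω
        _ = (∫ ω, S ω ^ k ∂P) * (|s| * C) ^ k := by
            rw [integral_const_mul]
            ring
        _ ≤ (∫ ω, S ω ^ k ∂P) * (|s| * C + 1) ^ k := by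
            have : 0 ≤ ∫ ω, S ω ^ k ∂P := integral_nonneg fun ω => pow_nonneg (hS ω) k
            gcongr
            linarith)
  have hcoeff (k : ℕ) : ∫ ω, (Complex.I * ((s * Y ω : ℝ) : ℂ)) ^ k / (k.factorial : ℂ) ∂P
      = s ^ k • (Complex.I ^ k * ((∫ ω, Y ω ^ k ∂P : ℝ) : ℂ) / (k.factorial : ℂ)) := by
    simp_rw [hterm]
    rw [integral_const_mul, integral_complex_ofReal, Complex.real_smul]
    push_cast
    ring
  have hexp (ω : Ω) : ∑' k : ℕ, (Complex.I * ((s * Y ω : ℝ) : ℂ)) ^ k / (k.factorial : ℂ)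
      = Complex.exp (Complex.I * ((s * Y ω : ℝ) : ℂ)) := by
    rw [Complex.exp_eq_exp_ℂ]
    exact (NormedSpace.expSeries_div_hasSum_exp _).tsum_eq
  simp_rw [hcoeff, hexp] at key
  exact key

/-- If the characteristic function of `s * Y` is `φ (-(s ^ 2 * q) / 2)` for every `s`, the even
moments of `Y` are read off from the Taylor coefficients of `φ`. -/
theorem even_moment_eq_of_hasSum {a : ℕ → ℂ} {φ : ℂ → ℂ} {M : ℕ → ℝ} {q : ℝ}
    (hent : ∀ z : ℂ, HasSum (fun n => a n * z ^ n) (φ z))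
    (hM : ∀ s : ℝ, HasSum (fun k : ℕ => s ^ k •
        (Complex.I ^ k * (M k : ℂ) / (k.factorial : ℂ))) (φ (Complex.ofReal (-(s ^ 2 * q) / 2))))
    (n : ℕ) : (M (2 * n) : ℂ) = ((2 * n).factorial : ℂ) * a n / 2 ^ n * (q : ℂ) ^ n := by
  have hinj : Function.Injective (fun n : ℕ => 2 * n) := fun x y h => by simpa using h
  have hφ (s : ℝ) : HasSum (fun k : ℕ => s ^ k •
      (if Even k then a (k / 2) * (-(q : ℂ) / 2) ^ (k / 2) else 0))
      (φ (Complex.ofReal (-(s ^ 2 * q) / 2))) := by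
    rw [← hinj.hasSum_iff]
    · convert hent (Complex.ofReal (-(s ^ 2 * q) / 2)) using 2 with n
      simp only [Function.comp_apply, even_two_mul, if_true, Complex.real_smul,
        Nat.mul_div_cancel_left, Nat.ofNat_pos]
      push_cast
      rw [pow_mul, mul_left_comm, ← mul_pow]
      ring
    · intro k hk
      have : ¬ Even k := fun ⟨r, hr⟩ => hk ⟨r, by simp [hr, two_mul]⟩
      simp [this]
  have h := congrFun (eq_of_forall_hasSum_pow_smul hM hφ) (2 * n)
  simp only [even_two_mul, if_true, Nat.mul_div_cancel_left, Nat.ofNat_pos] at h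
  have hf : ((2 * n).factorial : ℂ) ≠ 0 := by exact_mod_cast Nat.factorial_ne_zero _
  have hs : ((-1 : ℂ)) ^ n * (-1) ^ n = 1 := by rw [← mul_pow]; norm_num
  rw [div_eq_iff hf, pow_mul, Complex.I_sq] at h
  calc (M (2 * n) : ℂ) = (-1) ^ n * ((-1) ^ n * M (2 * n)) := by rw [← mul_assoc, hs, one_mul]
    _ = (-1) ^ n * (a n * ((-1) ^ n * ((q : ℂ) ^ n / 2 ^ n)) * ((2 * n).factorial : ℂ)) := by
        rw [h, ← div_pow, ← mul_pow]
        ring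
    _ = ((-1) ^ n * (-1) ^ n) * (((2 * n).factorial : ℂ) * a n / 2 ^ n * (q : ℂ) ^ n) := by ring
    _ = _ := by rw [hs, one_mul]

open Finset in
/-- Comparing coefficients: if the multinomial expansion weighted by `μ` equals `c (∑ uⱼ²)ⁿ` for
all real `u`, then the weights at even multi-indices are determined. -/
theorem eq_of_forall_sum_multinomial_eq {σ : Type*} [Fintype σ] [DecidableEq σ] {n : ℕ}
    {μ : (σ → ℕ) → ℂ} {c : ℂ}
    (h : ∀ u : σ → ℝ, ∑ k ∈ piAntidiag univ (2 * n),
        (Nat.multinomial univ k : ℂ) * μ k * ∏ j, (u j : ℂ) ^ k j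
      = c * (∑ j, (u j : ℂ) ^ 2) ^ n) (β : σ → ℕ) (hβ : ∑ j, β j = n) :
    (Nat.multinomial univ (fun j => 2 * β j) : ℂ) * μ (fun j => 2 * β j)
      = c * Nat.multinomial univ β := by
  let e : (σ → ℕ) ≃ (σ →₀ ℕ) := Finsupp.equivFunOnFinite.symm
  let p : MvPolynomial σ ℂ := ∑ k ∈ piAntidiag univ (2 * n),
    MvPolynomial.monomial (e k) ((Nat.multinomial univ k : ℂ) * μ k)
  let q : MvPolynomial σ ℂ := ∑ k ∈ piAntidiag univ n,
    MvPolynomial.monomial (e fun j => 2 * k j) (c * Nat.multinomial univ k)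
  have hpq : p = q := by
    refine MvPolynomial.funext_set (fun _ => Set.range ((↑) : ℝ → ℂ))
      (fun _ => Set.infinite_range_of_injective Complex.ofReal_injective) fun x hx => ?_
    choose u hu using fun j => hx j (Set.mem_univ j)
    obtain rfl : (fun j => (u j : ℂ)) = x := funext hu
    have h' := h u
    rw [sum_pow_eq_sum_piAntidiag, mul_sum] at h'
    simpa [p, q, e, MvPolynomial.eval_monomial, Finsupp.prod_fintype, pow_mul, mul_assoc]
      using h'
  have hc := congrArg (MvPolynomial.coeff (e fun j => 2 * β j)) hpq
  have hinj (k : σ → ℕ) : (fun j => 2 * k j) = (fun j => 2 * β j) ↔ k = β := by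
    simp [funext_iff]
  simpa [p, q, MvPolynomial.coeff_sum, MvPolynomial.coeff_monomial, hinj, ← mul_sum, hβ] using hc

open Finset in
/-- Expectation of the multinomial expansion of a power of a linear combination. -/
theorem integral_sum_mul_pow {Ω σ : Type*} [MeasurableSpace Ω] {P : Measure Ω} [Fintype σ]
    [DecidableEq σ] {X : σ → Ω → ℝ} {N : ℕ}
    (hX : ∀ k ∈ piAntidiag univ N, Integrable (fun ω => ∏ j, X j ω ^ k j) P) (u : σ → ℝ) :
    ∫ ω, (∑ j, u j * X j ω) ^ N ∂P = ∑ k ∈ piAntidiag univ N,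
      (Nat.multinomial univ k : ℝ) * (∫ ω, ∏ j, X j ω ^ k j ∂P) * ∏ j, u j ^ k j := by
  have (ω : Ω) : (∑ j, u j * X j ω) ^ N = ∑ k ∈ piAntidiag univ N,
      ((Nat.multinomial univ k : ℝ) * ∏ j, u j ^ k j) * ∏ j, X j ω ^ k j := by
    simp_rw [sum_pow_eq_sum_piAntidiag, mul_pow, prod_mul_distrib, mul_assoc]
  simp_rw [this]
  rw [integral_finsetSum _ fun k hk => (hX k hk).const_mul _]
  refine sum_congr rfl fun k _ => ?_
  rw [integral_const_mul]
  ring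

/-- If real random variables `X₁, …, X_m` have all joint absolute moments finite with
`∑ E[(|X₁|+⋯+|X_m|)^k] r^k / k!` convergent for every `r > 0`, and their joint
characteristic function is `E[exp(i ∑ tⱼXⱼ)] = φ(−(∑ tⱼ²)/2)` for an entire
`φ(z) = ∑ aₙ zⁿ`, then for all `β₁, …, β_m ∈ ℕ` with `n = ∑ βⱼ`,
`E[∏ Xⱼ^{2βⱼ}] = (n! aₙ / 2ⁿ) ∏ⱼ (2βⱼ)!/βⱼ!`. -/
theorem even_mixed_moments_orthonormal {Ω : Type*} [MeasurableSpace Ω] (P : Measure Ω)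
    [IsProbabilityMeasure P] (m : ℕ) (X : Fin m → Ω → ℝ)
    (hint : ∀ k : ℕ, Integrable (fun ω => (∑ j, |X j ω|) ^ k) P)
    (hmom : ∀ r : ℝ, 0 < r →
      Summable (fun k : ℕ => (∫ ω, (∑ j, |X j ω|) ^ k ∂P) * r ^ k / (k.factorial : ℝ)))
    (φ : ℂ → ℂ) (a : ℕ → ℂ)
    (hent : ∀ z : ℂ, HasSum (fun n => a n * z ^ n) (φ z))
    (hchar : ∀ t : Fin m → ℝ,
      ∫ ω, Complex.exp (Complex.I * ((∑ j, t j * X j ω : ℝ) : ℂ)) ∂P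
        = φ (Complex.ofReal (-(∑ j, (t j) ^ 2) / 2))) :
    ∀ β : Fin m → ℕ,
      ((∫ ω, ∏ j, X j ω ^ (2 * β j) ∂P : ℝ) : ℂ)
        = (((∑ j, β j).factorial : ℂ) * a (∑ j, β j) / 2 ^ (∑ j, β j))
            * ∏ j, (((2 * β j).factorial : ℂ) / ((β j).factorial : ℂ)) := by
  intro β
  have hφ0 : φ 0 = 1 := by simpa using (hchar 0).symm
  have hφc : ContinuousAt φ 0 :=
    (hasFPowerSeriesAt_of_forall_hasSum (f := φ) (c := a)
      fun z => by simpa [mul_comm] using hent z).continuousAt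
  have hX (j : Fin m) : AEStronglyMeasurable (X j) P := by
    refine aestronglyMeasurable_of_eventually_exp (eventually_nhdsWithin_of_eventually_nhds ?_)
    have hc : ContinuousAt (fun s : ℝ => φ (Complex.ofReal (-(s ^ 2) / 2))) 0 :=
      ContinuousAt.comp (g := φ) (f := fun s : ℝ => Complex.ofReal (-(s ^ 2) / 2))
        (by simpa using hφc) (by fun_prop)
    filter_upwards [hc.eventually_ne (y := 0) (by simp [hφ0])] with s hs
    have h := hchar (Pi.single j s)
    simp only [Pi.single_apply, ite_mul, zero_mul, ite_pow, ne_eq, OfNat.ofNat_ne_zero,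
      not_false_eq_true, zero_pow, Finset.sum_ite_eq', Finset.mem_univ, if_true] at h
    exact (Integrable.of_integral_ne_zero (h ▸ hs)).aestronglyMeasurable
  have hle (j : Fin m) (ω : Ω) : |X j ω| ≤ ∑ i, |X i ω| :=
    Finset.single_le_sum (f := fun i => |X i ω|) (fun i _ => abs_nonneg _) (Finset.mem_univ j)
  have hprod (k : Fin m → ℕ) : Integrable (fun ω => ∏ j, X j ω ^ k j) P := by
    refine (hint (∑ j, k j)).mono'
      (Finset.aestronglyMeasurable_fun_prod _ fun j _ => (hX j).pow (k j)) (ae_of_all _ fun ω => ?_)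
    rw [Real.norm_eq_abs, Finset.abs_prod, ← Finset.prod_pow_eq_pow_sum]
    refine Finset.prod_le_prod (fun j _ => abs_nonneg _) fun j _ => ?_
    rw [abs_pow]
    exact pow_le_pow_left₀ (abs_nonneg _) (hle j ω) _
  have hlin (n : ℕ) (u : Fin m → ℝ) : ((∫ ω, (∑ j, u j * X j ω) ^ (2 * n) ∂P : ℝ) : ℂ)
      = ((2 * n).factorial : ℂ) * a n / 2 ^ n * ((∑ j, u j ^ 2 : ℝ) : ℂ) ^ n := by
    refine even_moment_eq_of_hasSum (M := fun k => ∫ ω, (∑ j, u j * X j ω) ^ k ∂P) hent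
      (fun s => ?_) n
    have h := hasSum_integral_exp_of_abs_le (P := P) (S := fun ω => ∑ j, |X j ω|)
      (Y := fun ω => ∑ j, u j * X j ω) (C := ∑ j, |u j|) (by positivity)
      (Finset.aestronglyMeasurable_fun_sum _ fun j _ => (hX j).const_mul (u j))
      (fun ω => by
        rw [Finset.sum_mul]
        refine (Finset.abs_sum_le_sum_abs _ _).trans (Finset.sum_le_sum fun j _ => ?_)
        rw [abs_mul]
        exact mul_le_mul_of_nonneg_left (hle j ω) (abs_nonneg _))
      hint (fun ω => by positivity) hmom s
    have hs := hchar (fun j => s * u j)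
    simp_rw [mul_assoc, mul_pow, ← Finset.mul_sum] at hs
    rwa [hs] at h
  generalize hn : ∑ j, β j = n
  have key := eq_of_forall_sum_multinomial_eq (n := n)
    (μ := fun k => ((∫ ω, ∏ j, X j ω ^ k j ∂P : ℝ) : ℂ))
    (c := ((2 * n).factorial : ℂ) * a n / 2 ^ n)
    (fun u => by
      have h := hlin n u
      rw [integral_sum_mul_pow fun k _ => hprod k] at h
      push_cast at h ⊢
      exact h) β hn
  have hm2 : (∏ j, ((2 * β j).factorial : ℂ)) * Nat.multinomial Finset.univ (fun j => 2 * β j)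
      = ((2 * n).factorial : ℂ) := by
    have := Nat.multinomial_spec Finset.univ (fun j => 2 * β j)
    rw [← Finset.mul_sum, hn] at this
    exact_mod_cast this
  have hm1 : (∏ j, ((β j).factorial : ℂ)) * Nat.multinomial Finset.univ β
      = (n.factorial : ℂ) := by
    have := Nat.multinomial_spec Finset.univ β
    rw [hn] at this
    exact_mod_cast this
  have hf : (∏ j, ((β j).factorial : ℂ)) ≠ 0 :=
    Finset.prod_ne_zero_iff.2 fun j _ => by exact_mod_cast Nat.factorial_ne_zero _
  have hmul : (Nat.multinomial Finset.univ (fun j => 2 * β j) : ℂ) ≠ 0 := by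
    exact_mod_cast (Nat.multinomial_pos _ _).ne'
  rw [Finset.prod_div_distrib, ← hm1]
  refine mul_left_cancel₀ hmul (key.trans ?_)
  rw [← hm2]
  field_simp
end

section
/- Let A, C, D > 0 and let ζ_j : ℝ → ℝ (j = 1, 2, …) be continuous functions such that |ζ_j(t)| ≤ A for all j and t, and |ζ_j(t) − ζ_j(s)| ≤ |t−s|·(C·√j + D) for all j, t, s. Define F : ℝ → ℓ²(ℕ, ℝ) by F(t)_j := 2^{−j/2}·∫_0^t ζ_j(v) dv and G : ℝ → ℓ²(ℕ, ℝ) by G(t)_j := 2^{−j/2}·ζ_j(t). Then F(t) and G(t) indeed lie in ℓ² for every t, and F is differentiable at every t ∈ ℝ with derivative G(t); moreover ‖(F(t+h) − F(t))/h − G(t)‖_{ℓ²}² ≤ M·h² with M := ∑_{j=1}^∞ (C√j + D)²/2^j < ∞. -/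
noncomputable section

theorem two_rpow_neg_half_sq (j : ℕ) :
    ((2 : ℝ) ^ (-((j : ℝ) + 1) / 2)) ^ 2 = 1 / 2 ^ (j + 1) := by
  rw [← Real.rpow_natCast, ← Real.rpow_mul (by norm_num)]
  have : -((j : ℝ) + 1) / 2 * ((2 : ℕ) : ℝ) = -((j + 1 : ℕ) : ℝ) := by push_cast; ring
  rw [this, Real.rpow_neg (by norm_num), Real.rpow_natCast, one_div]

theorem memℓp_weighted_of_bounded {a : ℕ → ℝ} {B : ℝ} (ha : ∀ j, |a j| ≤ B) :
    Memℓp (fun j : ℕ => (2 : ℝ) ^ (-((j : ℝ) + 1) / 2) * a j) 2 := by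
  refine memℓp_gen ?_
  have hgeom : Summable fun j : ℕ => B ^ 2 * (1 / 2 : ℝ) ^ (j + 1) :=
    ((summable_nat_add_iff 1).2 summable_geometric_two).mul_left _
  refine hgeom.of_nonneg_of_le (fun j => by positivity) fun j => ?_
  have hsq : a j ^ 2 ≤ B ^ 2 := by
    rw [← sq_abs]
    exact pow_le_pow_left₀ (abs_nonneg _) (ha j) 2
  simp only [ENNReal.toReal_ofNat, Real.rpow_ofNat, Real.norm_eq_abs, sq_abs]
  rw [mul_pow, two_rpow_neg_half_sq, mul_comm, one_div_pow]
  gcongr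

theorem summable_sqrt_affine_sq_div_two_pow {C D : ℝ} (hC : 0 ≤ C) (hD : 0 ≤ D) :
    Summable (fun j : ℕ => (C * Real.sqrt (j + 1) + D) ^ 2 / 2 ^ (j + 1)) := by
  have hs : Summable fun j : ℕ =>
      (C + D) ^ 2 * (((j + 1 : ℕ) : ℝ) ^ 1 * (1 / 2 : ℝ) ^ (j + 1)) := by
    refine Summable.mul_left _ ((summable_nat_add_iff
      (f := fun j : ℕ => (j : ℝ) ^ 1 * (1 / 2 : ℝ) ^ j) 1).2 ?_)
    exact summable_pow_mul_geometric_of_norm_lt_one 1 (by norm_num)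
  refine hs.of_nonneg_of_le (fun j => by positivity) fun j => ?_
  have hone : 1 ≤ Real.sqrt ((j : ℝ) + 1) := by
    rw [Real.one_le_sqrt]
    linarith [(Nat.cast_nonneg j : (0 : ℝ) ≤ j)]
  have hle : (C * Real.sqrt (j + 1) + D) ^ 2 ≤ (C + D) ^ 2 * ((j : ℝ) + 1) := by
    calc (C * Real.sqrt (j + 1) + D) ^ 2 ≤ ((C + D) * Real.sqrt (j + 1)) ^ 2 := by
          refine pow_le_pow_left₀ (by positivity) ?_ 2
          nlinarith
      _ = _ := by rw [mul_pow, Real.sq_sqrt (by positivity)]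
  rw [one_div_pow, pow_one, div_eq_mul_one_div, ← mul_assoc]
  push_cast
  gcongr

theorem abs_average_sub_le_of_lipschitz {f : ℝ → ℝ} (hf : Continuous f) {K : ℝ} (hK : 0 ≤ K)
    (hlip : ∀ t s, |f t - f s| ≤ |t - s| * K) (t : ℝ) {h : ℝ} (hh : h ≠ 0) :
    |1 / h * ((∫ v in (0 : ℝ)..t + h, f v) - ∫ v in (0 : ℝ)..t, f v) - f t| ≤ K * |h| := by
  have hfi : ∀ a b, IntervalIntegrable f MeasureTheory.volume a b :=
    fun a b => hf.intervalIntegrable a b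
  have heq : 1 / h * ((∫ v in (0 : ℝ)..t + h, f v) - ∫ v in (0 : ℝ)..t, f v) - f t
      = 1 / h * ∫ v in t..t + h, (f v - f t) := by
    rw [intervalIntegral.integral_interval_sub_left (hfi _ _) (hfi _ _),
      intervalIntegral.integral_sub (hfi _ _) intervalIntegrable_const,
      intervalIntegral.integral_const, smul_eq_mul]
    field_simp
    ring
  have hbound : ‖∫ v in t..t + h, (f v - f t)‖ ≤ K * |h| * |t + h - t| := by
    refine intervalIntegral.norm_integral_le_of_norm_le_const fun v hv => ?_
    have hv' : |v - t| ≤ |h| := by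
      simpa using Set.abs_sub_left_of_mem_uIcc (Set.uIoc_subset_uIcc hv)
    calc ‖f v - f t‖ ≤ |v - t| * K := hlip v t
      _ ≤ K * |h| := by rw [mul_comm]; gcongr
  rw [add_sub_cancel_left, Real.norm_eq_abs] at hbound
  have hpos : 0 < |h| := abs_pos.2 hh
  rw [heq, abs_mul, abs_div, abs_one, one_div, inv_mul_le_iff₀ hpos]
  linarith

/-- Given uniformly bounded functions `ζⱼ` with Lipschitz bounds `|ζⱼ(t) − ζⱼ(s)| ≤
|t−s|(C√j + D)` (here `ζ j` stands for `ζ_{j+1}`, `j = 1, 2, …`), the curves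
`F(t)ⱼ = 2^{−j/2} ∫₀ᵗ ζⱼ` and `G(t)ⱼ = 2^{−j/2} ζⱼ(t)` take values in `ℓ²`, the constant
`M = ∑ⱼ (C√j + D)²/2ʲ` is finite, `F` is differentiable with derivative `G(t)` at every
`t`, and `‖(F(t+h) − F(t))/h − G(t)‖² ≤ M h²`. -/
theorem process_differentiable (A C D : ℝ) (hA : 0 < A) (hC : 0 < C) (hD : 0 < D)
    (ζ : ℕ → ℝ → ℝ) (hcont : ∀ j, Continuous (ζ j))
    (hbd : ∀ j t, |ζ j t| ≤ A)
    (hlip : ∀ j t s, |ζ j t - ζ j s| ≤ |t - s| * (C * Real.sqrt (j + 1) + D)) :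
    (∀ t : ℝ, Memℓp (fun j : ℕ => (2 : ℝ) ^ (-((j : ℝ) + 1) / 2) * ∫ v in (0:ℝ)..t, ζ j v) 2) ∧
    (∀ t : ℝ, Memℓp (fun j : ℕ => (2 : ℝ) ^ (-((j : ℝ) + 1) / 2) * ζ j t) 2) ∧
    Summable (fun j : ℕ => (C * Real.sqrt (j + 1) + D) ^ 2 / 2 ^ (j + 1)) ∧
    ∀ (F G : ℝ → lp (fun _ : ℕ => ℝ) 2),
      (∀ t j, (F t : ∀ _ : ℕ, ℝ) j = (2 : ℝ) ^ (-((j : ℝ) + 1) / 2) * ∫ v in (0:ℝ)..t, ζ j v) →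
      (∀ t j, (G t : ∀ _ : ℕ, ℝ) j = (2 : ℝ) ^ (-((j : ℝ) + 1) / 2) * ζ j t) →
      (∀ t : ℝ, HasDerivAt F (G t) t) ∧
      ∀ t h : ℝ, h ≠ 0 →
        ‖(1 / h) • (F (t + h) - F t) - G t‖ ^ 2
          ≤ (∑' j : ℕ, (C * Real.sqrt (j + 1) + D) ^ 2 / 2 ^ (j + 1)) * h ^ 2 := by
  have hsum := summable_sqrt_affine_sq_div_two_pow hC.le hD.le
  refine ⟨fun t => memℓp_weighted_of_bounded (B := A * |t - 0|) fun j => by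
      rw [← Real.norm_eq_abs]
      exact intervalIntegral.norm_integral_le_of_norm_le_const fun v _ => hbd j v,
    fun t => memℓp_weighted_of_bounded fun j => hbd j t, hsum, fun F G hF hG => ?_⟩
  set M := ∑' j : ℕ, (C * Real.sqrt (j + 1) + D) ^ 2 / 2 ^ (j + 1)
  have key : ∀ t h : ℝ, h ≠ 0 → ‖(1 / h) • (F (t + h) - F t) - G t‖ ^ 2 ≤ M * h ^ 2 := by
    intro t h hh
    have hnorm := lp.hasSum_norm (p := 2) (by norm_num) ((1 / h) • (F (t + h) - F t) - G t)
    simp only [ENNReal.toReal_ofNat, Real.rpow_ofNat] at hnorm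
    refine hasSum_le (fun j => ?_) hnorm (hsum.hasSum.mul_right (h ^ 2))
    have hcoord : ((1 / h) • (F (t + h) - F t) - G t : lp (fun _ : ℕ => ℝ) 2) j
        = (2 : ℝ) ^ (-((j : ℝ) + 1) / 2) *
          (1 / h * ((∫ v in (0 : ℝ)..t + h, ζ j v) - ∫ v in (0 : ℝ)..t, ζ j v) - ζ j t) := by
      simp only [lp.coeFn_sub, lp.coeFn_smul, Pi.sub_apply, Pi.smul_apply, smul_eq_mul, hF, hG]
      ring
    have havg := pow_le_pow_left₀ (abs_nonneg _)
      (abs_average_sub_le_of_lipschitz (hcont j) (by positivity) (hlip j) t hh) 2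
    rw [sq_abs, mul_pow, sq_abs] at havg
    rw [hcoord, Real.norm_eq_abs, sq_abs, mul_pow, two_rpow_neg_half_sq]
    calc _ ≤ 1 / 2 ^ (j + 1) * ((C * Real.sqrt (j + 1) + D) ^ 2 * h ^ 2) := by gcongr
      _ = _ := by ring
  refine ⟨fun t => ?_, key⟩
  rw [hasDerivAt_iff_tendsto_slope_zero, tendsto_iff_norm_sub_tendsto_zero]
  have hlim : Filter.Tendsto (fun h : ℝ => Real.sqrt (M * h ^ 2)) (nhdsWithin 0 {0}ᶜ) (nhds 0) := by
    have hc : Continuous fun h : ℝ => Real.sqrt (M * h ^ 2) := by fun_prop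
    simpa using (hc.tendsto 0).mono_left nhdsWithin_le_nhds
  refine squeeze_zero' (Filter.Eventually.of_forall fun h => norm_nonneg _) ?_ hlim
  filter_upwards [self_mem_nhdsWithin] with h hh
  rw [← one_div]
  exact Real.le_sqrt_of_sq_le (key t h hh)
end
end
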